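/- arXiv:1703.03706 — 4 statements merged into one kernel-verified Lean document; each statement's English description precedes it below -/
import Mathlib

section
/- (Adaptive-to-non-adaptive reduction for environment-parametrized memory cells.) Let (𝒳, {θ^x}_{x∈𝒳}, F) be an environment-parametrized memory cell with channels 𝓔^x(ρ) := F(ρ⊗θ^x) from ℂ^{d_A} to ℂ^{d_B}, where the θ^x are density matrices on ℂ^{d_E} and F is a trace-preserving Kraus channel from ℂ^{d_A}⊗ℂ^{d_E} to ℂ^{d_B}. For every n-step adaptive strategy — consisting of finite reference dimensions d_{R_1},…,d_{R_n}, an initial density matrix ρ^{(1)} on ℂ^{d_{R_1}}⊗ℂ^{d_A}, trace-preserving Kraus channels 𝒜^i from ℂ^{d_{R_i}}⊗ℂ^{d_B} to ℂ^{d_{R_{i+1}}}⊗ℂ^{d_A} for 1 ≤ i ≤ n−1, and a POVM {Λ_m}_{m∈M} on ℂ^{d_{R_n}}⊗ℂ^{d_B} — there exists a POVM {Γ_m}_{m∈M} on (ℂ^{d_E})^{⊗n} such that for every sequence x ∈ 𝒳^n and every outcome m ∈ M: Tr{Λ_m ((id⊗𝓔^{x_n})∘𝒜^{n−1}∘⋯∘𝒜^1∘(id⊗𝓔^{x_1}))(ρ^{(1)})}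 = Tr{Γ_m (θ^{x_1}⊗⋯⊗θ^{x_n})}. -/
open Matrix Kronecker BigOperators ComplexOrder

/-- Application of a map given by a Kraus family. -/
noncomputable def krausApply {a b ι : Type*} [Fintype a] [Fintype b] [Fintype ι]
    (K : ι → Matrix b a ℂ) (X : Matrix a a ℂ) : Matrix b b ℂ :=
  ∑ j, K j * X * (K j)ᴴ

/-- Application of `id_r ⊗ 𝓔` on the system `r × a`, where `𝓔(ρ) = F(ρ ⊗ θ)` is an
environment-parametrized channel with environment state `θ` and interaction Kraus
family `F`. -/
noncomputable def envApply {r a e b ι : Type*} [Fintype r] [DecidableEq r]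
    [Fintype a] [Fintype e] [Fintype b] [Fintype ι]
    (F : ι → Matrix b (a × e) ℂ) (θ : Matrix e e ℂ)
    (X : Matrix (r × a) (r × a) ℂ) : Matrix (r × b) (r × b) ℂ :=
  ∑ j, ((1 : Matrix r r ℂ) ⊗ₖ F j) *
      (Matrix.reindex (Equiv.prodAssoc r a e) (Equiv.prodAssoc r a e) (X ⊗ₖ θ)) *
      ((1 : Matrix r r ℂ) ⊗ₖ F j)ᴴ

/-- State after `i + 1` interleaved calls to an environment-parametrized memory cell. -/
noncomputable def adaptEnvState (dA dB dE : ℕ) {𝒳 : Type} (kF : ℕ)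
    (F : Fin kF → Matrix (Fin dB) (Fin dA × Fin dE) ℂ)
    (θ : 𝒳 → Matrix (Fin dE) (Fin dE) ℂ)
    (dR : ℕ → ℕ) (kA : ℕ → ℕ)
    (A : (i : ℕ) → Fin (kA i) →
      Matrix (Fin (dR (i + 1)) × Fin dA) (Fin (dR i) × Fin dB) ℂ)
    (ρ0 : Matrix (Fin (dR 0) × Fin dA) (Fin (dR 0) × Fin dA) ℂ)
    (xseq : ℕ → 𝒳) :
    (i : ℕ) → Matrix (Fin (dR i) × Fin dB) (Fin (dR i) × Fin dB) ℂ
  | 0 => envApply F (θ (xseq 0)) ρ0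
  | (i + 1) => envApply F (θ (xseq (i + 1)))
      (krausApply (A i) (adaptEnvState dA dB dE kF F θ dR kA A ρ0 xseq i))

theorem sum_kronecker {a b c e ι : Type*} [Fintype ι] (K : ι → Matrix b a ℂ) (X : Matrix c e ℂ) :
    (∑ j, K j) ⊗ₖ X = ∑ j, K j ⊗ₖ X := by
  ext p q
  simp [Matrix.sum_apply, Finset.sum_mul]

theorem kronecker_sum {a b c e ι : Type*} [Fintype ι] (K : ι → Matrix b a ℂ) (X : Matrix c e ℂ) :
    X ⊗ₖ (∑ j, K j) = ∑ j, X ⊗ₖ K j := by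
  ext p q
  simp [Matrix.sum_apply, Finset.mul_sum]

theorem sum_conjTranspose_mul_comp {a b c ι κ : Type*} [Fintype b] [Fintype c]
    [Fintype ι] [Fintype κ] [DecidableEq a] [DecidableEq b]
    (K : ι → Matrix c b ℂ) (L : κ → Matrix b a ℂ)
    (hK : ∑ j, (K j)ᴴ * K j = 1) (hL : ∑ j, (L j)ᴴ * L j = 1) :
    ∑ p : ι × κ, (K p.1 * L p.2)ᴴ * (K p.1 * L p.2) = 1 := by
  rw [Fintype.sum_prod_type_right, ← hL]
  refine Finset.sum_congr rfl fun l _ => ?_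
  calc ∑ k, (K k * L l)ᴴ * (K k * L l) = (L l)ᴴ * (∑ k, (K k)ᴴ * K k) * L l := by
        simp only [conjTranspose_mul, Matrix.mul_sum, Matrix.sum_mul, Matrix.mul_assoc]
    _ = (L l)ᴴ * L l := by rw [hK, Matrix.mul_one]

theorem sum_conjTranspose_mul_submatrix {a b c ι : Type*} [Fintype b] [Fintype ι]
    [DecidableEq a] [DecidableEq c] (f : c ≃ a) (K : ι → Matrix b a ℂ) (hK : ∑ j, (K j)ᴴ * K j = 1) :
    ∑ j, ((K j).submatrix id f)ᴴ * (K j).submatrix id f = 1 := by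
  have h (j : ι) : ((K j).submatrix id f)ᴴ * (K j).submatrix id f
      = ((K j)ᴴ * K j).submatrix f f := by
    rw [conjTranspose_submatrix]
    exact submatrix_mul_equiv _ _ f (Equiv.refl b) f
  simp only [h]
  rw [← submatrix_one_equiv f, ← hK]
  ext p q
  simp [Matrix.sum_apply]

section KrausComposition

variable {a b c e r ι κ : Type*} [Fintype a] [Fintype b] [Fintype c] [Fintype e] [Fintype r]
  [Fintype ι] [Fintype κ]

theorem krausApply_krausApply (K : ι → Matrix c b ℂ) (L : κ → Matrix b a ℂ) (X : Matrix a a ℂ) :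
    krausApply K (krausApply L X) = krausApply (fun p : ι × κ => K p.1 * L p.2) X := by
  simp only [krausApply, Fintype.sum_prod_type, Matrix.mul_sum, Matrix.sum_mul,
    conjTranspose_mul, Matrix.mul_assoc]

theorem krausApply_kronecker_one [DecidableEq e] (K : ι → Matrix b a ℂ) (X : Matrix a a ℂ)
    (θ : Matrix e e ℂ) :
    krausApply (fun j => K j ⊗ₖ (1 : Matrix e e ℂ)) (X ⊗ₖ θ) = krausApply K X ⊗ₖ θ := by
  simp only [krausApply, sum_kronecker, conjTranspose_kronecker, ← mul_kronecker_mul,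
    conjTranspose_one, Matrix.one_mul, Matrix.mul_one]

theorem sum_conjTranspose_mul_kronecker_one [DecidableEq a] [DecidableEq e]
    (K : ι → Matrix b a ℂ) (hK : ∑ j, (K j)ᴴ * K j = 1) :
    ∑ j, (K j ⊗ₖ (1 : Matrix e e ℂ))ᴴ * (K j ⊗ₖ (1 : Matrix e e ℂ)) = 1 := by
  simp only [conjTranspose_kronecker, ← mul_kronecker_mul, conjTranspose_one, Matrix.one_mul,
    ← sum_kronecker, hK, one_kronecker_one]

theorem sum_conjTranspose_mul_one_kronecker [DecidableEq a] [DecidableEq r]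
    (K : ι → Matrix b a ℂ) (hK : ∑ j, (K j)ᴴ * K j = 1) :
    ∑ j, ((1 : Matrix r r ℂ) ⊗ₖ K j)ᴴ * ((1 : Matrix r r ℂ) ⊗ₖ K j) = 1 := by
  simp only [conjTranspose_kronecker, ← mul_kronecker_mul, conjTranspose_one, Matrix.one_mul,
    ← kronecker_sum, hK, one_kronecker_one]

theorem krausApply_submatrix (f : c ≃ a) (K : ι → Matrix b a ℂ) (X : Matrix a a ℂ) :
    krausApply (fun j => (K j).submatrix id f) (X.submatrix f f) = krausApply K X := by
  simp only [krausApply, conjTranspose_submatrix, submatrix_mul_equiv, submatrix_id_id]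

theorem envApply_eq_krausApply [DecidableEq r] (F : ι → Matrix b (a × e) ℂ) (θ : Matrix e e ℂ)
    (X : Matrix (r × a) (r × a) ℂ) :
    envApply F θ X = krausApply
      (fun j => ((1 : Matrix r r ℂ) ⊗ₖ F j).submatrix id (Equiv.prodAssoc r a e)) (X ⊗ₖ θ) := by
  rw [← krausApply_submatrix (Equiv.prodAssoc r a e).symm]
  simp only [submatrix_submatrix, Function.comp_id, Equiv.self_comp_symm, submatrix_id_id]
  rfl

/-- The Heisenberg-picture duality for a map given by a Kraus family. -/
theorem trace_mul_krausApply (K : ι → Matrix b a ℂ) (Y : Matrix b b ℂ) (X : Matrix a a ℂ) :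
    (Y * krausApply K X).trace = (krausApply (fun j => (K j)ᴴ) Y * X).trace := by
  simp only [krausApply, Matrix.mul_sum, Matrix.sum_mul, trace_sum, conjTranspose_conjTranspose]
  refine Finset.sum_congr rfl fun j _ => ?_
  rw [← Matrix.mul_assoc, trace_mul_comm]
  simp only [Matrix.mul_assoc]

theorem krausApply_sum (K : ι → Matrix b a ℂ) (X : κ → Matrix a a ℂ) :
    krausApply K (∑ m, X m) = ∑ m, krausApply K (X m) := by
  simp only [krausApply, Matrix.mul_sum, Matrix.sum_mul]
  exact Finset.sum_comm

theorem Matrix.PosSemidef.krausApply (K : ι → Matrix b a ℂ) {X : Matrix a a ℂ}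
    (hX : X.PosSemidef) : (krausApply K X).PosSemidef :=
  Matrix.posSemidef_sum _ fun j _ => hX.mul_mul_conjTranspose_same (K j)

/-- A density matrix is the output of a channel acting on a one-dimensional system. -/
theorem exists_krausApply_one_eq [Unique c] {ρ : Matrix a a ℂ} (hρ : ρ.PosSemidef)
    (htr : ρ.trace = 1) :
    ∃ (m : ℕ) (K : Fin m → Matrix a c ℂ), ∑ j, (K j)ᴴ * K j = 1 ∧ krausApply K 1 = ρ := by
  obtain ⟨m, v, rfl⟩ := posSemidef_iff_eq_sum_vecMulVec.1 hρ
  refine ⟨m, fun j => Matrix.of fun p _ => v j p, ?_, ?_⟩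
  · ext p q
    obtain rfl := Subsingleton.elim p q
    simpa [Matrix.sum_apply, Matrix.mul_apply, Matrix.trace_sum, dotProduct, mul_comm] using htr
  · ext p q
    simp [krausApply, Matrix.sum_apply, Matrix.mul_apply, vecMulVec_apply]

end KrausComposition

/-- The tensor product `θ₀ ⊗ ⋯ ⊗ θₙ₋₁` of a finite sequence of matrices. -/
def tensorState {e : Type*} (n : ℕ) (θ : ℕ → Matrix e e ℂ) : Matrix (Fin n → e) (Fin n → e) ℂ :=
  Matrix.of fun r c => ∏ i : Fin n, θ i (r i) (c i)

/-- Splitting off the last entry of a tuple. -/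
def splitLast (e : Type*) (n : ℕ) : (Fin (n + 1) → e) ≃ (Fin n → e) × e :=
  ((Equiv.prodComm _ _).trans (Fin.snocEquiv fun _ : Fin (n + 1) => e)).symm

theorem tensorState_succ {e : Type*} (n : ℕ) (θ : ℕ → Matrix e e ℂ) :
    tensorState (n + 1) θ
      = (tensorState n θ ⊗ₖ θ n).submatrix (splitLast e n) (splitLast e n) := by
  ext r c
  simp [tensorState, splitLast, Fin.prod_univ_castSucc, Fin.snocEquiv, Fin.init]

theorem tensorState_zero {e : Type*} [DecidableEq e] (θ : ℕ → Matrix e e ℂ) :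
    tensorState 0 θ = 1 := by
  ext r c
  obtain rfl := Subsingleton.elim r c
  simp [tensorState]

/-- Calling the memory cell on the output of a channel acting on `n` environment states yields
the output of a channel acting on `n + 1` environment states. -/
theorem exists_krausApply_eq_envApply {a b e r ι κ : Type} [Fintype a] [Fintype b] [Fintype e]
    [Fintype r] [Fintype ι] [Fintype κ] [DecidableEq a] [DecidableEq e] [DecidableEq r]
    (F : ι → Matrix b (a × e) ℂ) (hF : ∑ j, (F j)ᴴ * F j = 1) (n : ℕ)
    (G : κ → Matrix (r × a) (Fin n → e) ℂ) (hG : ∑ j, (G j)ᴴ * G j = 1) :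
    ∃ H : ι × κ → Matrix (r × b) (Fin (n + 1) → e) ℂ, ∑ j, (H j)ᴴ * H j = 1 ∧
      ∀ θ : ℕ → Matrix e e ℂ, envApply F (θ n) (krausApply G (tensorState n θ))
        = krausApply H (tensorState (n + 1) θ) := by
  have hF' := sum_conjTranspose_mul_submatrix (Equiv.prodAssoc r a e) _
    (sum_conjTranspose_mul_one_kronecker (r := r) F hF)
  have hG' := sum_conjTranspose_mul_submatrix (splitLast e n) _
    (sum_conjTranspose_mul_kronecker_one (e := e) G hG)
  refine ⟨_, sum_conjTranspose_mul_comp _ _ hF' hG', fun θ => ?_⟩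
  rw [envApply_eq_krausApply, ← krausApply_kronecker_one,
    ← krausApply_submatrix (splitLast e n) (fun j => G j ⊗ₖ (1 : Matrix e e ℂ)),
    ← tensorState_succ, krausApply_krausApply]

/-- The state produced by an adaptive strategy is the output of a fixed channel acting on the
tensor product of the environment states. -/
theorem exists_krausApply_eq_adaptEnvState {𝒳 : Type} {dA dB dE kF : ℕ}
    (F : Fin kF → Matrix (Fin dB) (Fin dA × Fin dE) ℂ) (hF : ∑ j, (F j)ᴴ * F j = 1)
    (θ : 𝒳 → Matrix (Fin dE) (Fin dE) ℂ) (dR kA : ℕ → ℕ)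
    (ρ0 : Matrix (Fin (dR 0) × Fin dA) (Fin (dR 0) × Fin dA) ℂ)
    (hρ0 : ρ0.PosSemidef) (htr : ρ0.trace = 1)
    (A : (i : ℕ) → Fin (kA i) →
      Matrix (Fin (dR (i + 1)) × Fin dA) (Fin (dR i) × Fin dB) ℂ)
    (k : ℕ) (hA : ∀ i < k, ∑ j, (A i j)ᴴ * A i j = 1) :
    ∃ (κ : Type) (_ : Fintype κ) (G : κ → Matrix (Fin (dR k) × Fin dB) (Fin (k + 1) → Fin dE) ℂ),
      ∑ j, (G j)ᴴ * G j = 1 ∧ ∀ xseq : ℕ → 𝒳,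
        adaptEnvState dA dB dE kF F θ dR kA A ρ0 xseq k
          = krausApply G (tensorState (k + 1) fun i => θ (xseq i)) := by
  induction k with
  | zero =>
    obtain ⟨_, K, hK, hKρ⟩ := exists_krausApply_one_eq (c := Fin 0 → Fin dE) hρ0 htr
    obtain ⟨H, hH, hHθ⟩ := exists_krausApply_eq_envApply F hF 0 K (by convert hK)
    refine ⟨_, inferInstance, H, hH, fun xseq => ?_⟩
    rw [← hHθ, tensorState_zero, adaptEnvState]
    congr 1
    convert hKρ.symm
  | succ k ih =>
    obtain ⟨κ, _, G, hG, hGθ⟩ := ih fun i hi => hA i (by omega)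
    obtain ⟨H, hH, hHθ⟩ := exists_krausApply_eq_envApply F hF (k + 1) _
      (sum_conjTranspose_mul_comp (A k) G (hA k (by omega)) hG)
    refine ⟨_, inferInstance, H, hH, fun xseq => ?_⟩
    rw [← hHθ, adaptEnvState, hGθ, krausApply_krausApply]

/-- **Adaptive-to-non-adaptive reduction for environment-parametrized memory cells.**
Any adaptive strategy for reading an environment-parametrized memory cell is equivalent to a
fixed measurement (POVM) performed directly on the tensor product of the environment states. -/
theorem adaptive_to_nonadaptive_reduction
    {𝒳 : Type} [Nonempty 𝒳]
    {dA dB dE : ℕ}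
    (kF : ℕ) (F : Fin kF → Matrix (Fin dB) (Fin dA × Fin dE) ℂ)
    (hF : ∑ j, (F j)ᴴ * F j = 1)
    (θ : 𝒳 → Matrix (Fin dE) (Fin dE) ℂ)
    (hθ : ∀ x, (θ x).PosSemidef ∧ (θ x).trace = 1)
    {M : Type} [Fintype M] [DecidableEq M]
    (n : ℕ) (hn : 1 ≤ n)
    (dR : ℕ → ℕ) (kA : ℕ → ℕ)
    (ρ0 : Matrix (Fin (dR 0) × Fin dA) (Fin (dR 0) × Fin dA) ℂ)
    (hρ0 : ρ0.PosSemidef ∧ ρ0.trace = 1)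
    (A : (i : ℕ) → Fin (kA i) →
      Matrix (Fin (dR (i + 1)) × Fin dA) (Fin (dR i) × Fin dB) ℂ)
    (hA : ∀ i, i + 1 < n → ∑ j, (A i j)ᴴ * A i j = 1)
    (Λ : M → Matrix (Fin (dR (n - 1)) × Fin dB) (Fin (dR (n - 1)) × Fin dB) ℂ)
    (hΛpos : ∀ m, (Λ m).PosSemidef) (hΛsum : ∑ m, Λ m = 1) :
    ∃ Γ : M → Matrix (Fin n → Fin dE) (Fin n → Fin dE) ℂ,
      (∀ m, (Γ m).PosSemidef) ∧ (∑ m, Γ m = 1) ∧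
      ∀ (xseq : ℕ → 𝒳) (m : M),
        (Λ m * adaptEnvState dA dB dE kF F θ dR kA A ρ0 xseq (n - 1)).trace =
        (Γ m * Matrix.of (fun r c : Fin n → Fin dE =>
            ∏ i : Fin n, θ (xseq i) (r i) (c i))).trace := by
  obtain ⟨k, rfl⟩ : ∃ k, n = k + 1 := ⟨n - 1, by omega⟩
  obtain ⟨κ, _, G, hG, hGθ⟩ := exists_krausApply_eq_adaptEnvState F hF θ dR kA ρ0 hρ0.1 hρ0.2 A k
    fun i hi => hA i (by omega)
  refine ⟨fun m => krausApply (fun j => (G j)ᴴ) (Λ m), fun m => (hΛpos m).krausApply _, ?_,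
    fun xseq m => ?_⟩
  · rw [← krausApply_sum, hΛsum]
    simpa [krausApply] using hG
  · have h := trace_mul_krausApply G (Λ m) (tensorState (k + 1) fun i => θ (xseq i))
    rw [← hGθ] at h
    exact h
end

section
/- Let d ≥ 1 and q ∈ [0,1]. Define the qudit erasure channel Q^q from ℂ^d to ℂ^{d+1} by Q^q(ρ) := (1−q)·ι(ρ) + q·(Tr ρ)·|e⟩⟨e|, where ι(ρ) embeds the d×d matrix ρ into the top-left block of a (d+1)×(d+1) matrix (zero elsewhere) and |e⟩ is the (d+1)-st standard basis vector. Let ρ_{RB} := (id_d ⊗ Q^q)(Φ_d) be the Choi state, with marginals ρ_R (partial trace over the second factor) and ρ_B (partial trace over the first factor). Then the quantum mutual information satisfies H(ρ_R) + H(ρ_B) − H(ρ_{RB}) = 2(1−q)·log₂ d. -/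
open Matrix BigOperators

/-- von Neumann entropy (base 2) of a matrix, via its eigenvalues when Hermitian. -/
noncomputable def vnEntropy {n : Type*} [Fintype n] [DecidableEq n] (ρ : Matrix n n ℂ) : ℝ :=
  if h : ρ.IsHermitian then -∑ i, (h.eigenvalues i) * Real.logb 2 (h.eigenvalues i) else 0

/-- Partial trace over the second factor of a bipartite matrix. -/
noncomputable def ptrace2 {α β : Type*} [Fintype β]
    (ρ : Matrix (α × β) (α × β) ℂ) : Matrix α α ℂ :=
  Matrix.of fun r r' => ∑ b, ρ (r, b) (r', b)

/-- Partial trace over the first factor of a bipartite matrix. -/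
noncomputable def ptrace1 {α β : Type*} [Fintype α]
    (ρ : Matrix (α × β) (α × β) ℂ) : Matrix β β ℂ :=
  Matrix.of fun b b' => ∑ a, ρ (a, b) (a, b')

/-- The maximally entangled state `Φ_d` on `ℂ^d ⊗ ℂ^d`. -/
noncomputable def maxEnt (d : ℕ) : Matrix (Fin d × Fin d) (Fin d × Fin d) ℂ :=
  Matrix.of (fun p q => if p.1 = p.2 ∧ q.1 = q.2 then (d : ℂ)⁻¹ else 0)

/-- The qudit erasure channel `Q^q(ρ) = (1−q)·ι(ρ) + q·(Tr ρ)·|e⟩⟨e|` from `ℂ^d` to `ℂ^{d+1}`,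
where `ι` embeds `ρ` in the top-left block and `|e⟩` is the `(d+1)`-st basis vector. -/
noncomputable def erasure (d : ℕ) (q : ℝ) (ρ : Matrix (Fin d) (Fin d) ℂ) :
    Matrix (Fin (d + 1)) (Fin (d + 1)) ℂ :=
  Matrix.of fun i j =>
    (1 - q : ℂ) *
        (if hi : (i : ℕ) < d then if hj : (j : ℕ) < d then ρ ⟨i, hi⟩ ⟨j, hj⟩ else 0 else 0) +
      (q : ℂ) * ρ.trace * (if (i : ℕ) = d ∧ (j : ℕ) = d then 1 else 0)

/-- `id ⊗ Λ` for an entrywise-given map `Λ`, acting on the second tensor factor. -/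
noncomputable def idTensorMap {r a b : Type*}
    (Λ : Matrix a a ℂ → Matrix b b ℂ)
    (ρ : Matrix (r × a) (r × a) ℂ) : Matrix (r × b) (r × b) ℂ :=
  Matrix.of fun p q => Λ (Matrix.of fun s t => ρ (p.1, s) (q.1, t)) p.2 q.2

/-- The entropy of `C diag(μ) Cᴴ`, where the columns of `C` are orthogonal with squared norms `w`. -/
theorem vnEntropy_mul_diagonal_mul_conjTranspose {m n : Type*} [Fintype m] [DecidableEq m]
    [Fintype n] [DecidableEq n] (C : Matrix m n ℂ) (μ w : n → ℝ)
    (hC : Cᴴ * C = diagonal fun i => (w i : ℂ)) :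
    vnEntropy (C * diagonal (fun i => (μ i : ℂ)) * Cᴴ) =
      -∑ i, (μ i * w i) * Real.logb 2 (μ i * w i) := by
  have hH : (C * diagonal (fun i => (μ i : ℂ)) * Cᴴ).IsHermitian :=
    isHermitian_mul_mul_conjTranspose C (by
      rw [isHermitian_diagonal_iff]
      intro i
      simp [isSelfAdjoint_iff])
  have hD : diagonal (fun i => (μ i : ℂ)) * Cᴴ * C =
      diagonal fun i => ((μ i * w i : ℝ) : ℂ) := by
    rw [Matrix.mul_assoc, hC, diagonal_mul_diagonal]
    simp
  have hp := charpoly_mul_comm' C (diagonal (fun i => (μ i : ℂ)) * Cᴴ)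
  rw [← Matrix.mul_assoc, hD] at hp
  have hr := congrArg Polynomial.roots hp
  rw [Polynomial.roots_mul (mul_ne_zero (by simp) (charpoly_monic _).ne_zero),
    Polynomial.roots_mul (mul_ne_zero (by simp) (charpoly_monic _).ne_zero),
    hH.roots_charpoly_eq_eigenvalues, charpoly_diagonal, Polynomial.roots_prod _ _ (by
      exact Finset.prod_ne_zero_iff.mpr fun _ _ => Polynomial.X_sub_C_ne_zero _)] at hr
  have hs := congrArg
    (fun s : Multiset ℂ => (s.map fun z => z.re * Real.logb 2 z.re).sum) hr
  simp [-Complex.ofReal_mul, Multiset.map_nsmul, Multiset.sum_nsmul] at hs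
  rw [vnEntropy, dif_pos hH]
  exact congrArg Neg.neg hs

theorem vnEntropy_diagonal {n : Type*} [Fintype n] [DecidableEq n] (μ : n → ℝ) :
    vnEntropy (diagonal fun i => (μ i : ℂ)) = -∑ i, μ i * Real.logb 2 (μ i) := by
  simpa using vnEntropy_mul_diagonal_mul_conjTranspose (1 : Matrix n n ℂ) μ 1 (by simp)

/-- Up to normalisation, the eigenvectors of the Choi state of the erasure channel with nonzero
eigenvalue: the maximally entangled vector and the vectors `|r⟩ ⊗ |e⟩`. -/
noncomputable def erasureChoiVectors (d : ℕ) : Matrix (Fin d × Fin (d + 1)) (Option (Fin d)) ℂ :=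
  Matrix.of fun p k => k.elim (if p.1.castSucc = p.2 then 1 else 0)
    fun r => if p.2 = Fin.last d ∧ p.1 = r then 1 else 0

theorem erasureChoiVectors_conjTranspose_mul_self (d : ℕ) :
    (erasureChoiVectors d)ᴴ * erasureChoiVectors d =
      diagonal fun k => ((k.elim (d : ℝ) fun _ => 1 : ℝ) : ℂ) := by
  ext (_ | i) (_ | j) <;>
    simp [erasureChoiVectors, Matrix.mul_apply, Fintype.sum_prod_type, Fin.sum_univ_castSucc,
      Matrix.diagonal_apply, eq_comm]

theorem erasure_choi_apply (d : ℕ) (q : ℝ) (p p' : Fin d × Fin (d + 1)) :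
    idTensorMap (erasure d q) (maxEnt d) p p' =
      (1 - q) / d * (if p.1.castSucc = p.2 ∧ p'.1.castSucc = p'.2 then 1 else 0) +
        q / d * (if p.1 = p'.1 ∧ p.2 = Fin.last d ∧ p'.2 = Fin.last d then 1 else 0) := by
  obtain ⟨r, b⟩ := p
  obtain ⟨r', b'⟩ := p'
  have hne (i : Fin d) : (i : ℕ) ≠ d := i.isLt.ne
  rcases eq_or_ne r r' with rfl | h <;> induction b using Fin.lastCases <;>
    induction b' using Fin.lastCases <;>
    simp [idTensorMap, erasure, maxEnt, Matrix.trace, ite_and, div_eq_mul_inv, *, Ne.symm]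

theorem erasure_choi_eq (d : ℕ) (q : ℝ) :
    idTensorMap (erasure d q) (maxEnt d) =
      erasureChoiVectors d *
        diagonal (fun k : Option (Fin d) => ((k.elim ((1 - q) / d) fun _ => q / d : ℝ) : ℂ)) *
        (erasureChoiVectors d)ᴴ := by
  ext p p'
  rw [erasure_choi_apply]
  simp [erasureChoiVectors, Matrix.mul_apply, Fintype.sum_option,
    Matrix.diagonal_apply, ite_and]
  grind

theorem ptrace2_erasure_choi (d : ℕ) (q : ℝ) :
    ptrace2 (idTensorMap (erasure d q) (maxEnt d)) = diagonal fun _ => ((1 / d : ℝ) : ℂ) := by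
  ext r r'
  simp only [ptrace2, Matrix.of_apply, erasure_choi_apply, Fin.sum_univ_castSucc]
  rcases eq_or_ne r r' with rfl | h
  · simp
    ring
  · simp [ite_and, h, h.symm]

theorem ptrace1_erasure_choi (d : ℕ) (hd : 1 ≤ d) (q : ℝ) :
    ptrace1 (idTensorMap (erasure d q) (maxEnt d)) =
      diagonal fun b => ((Fin.lastCases q (fun _ => (1 - q) / d) b : ℝ) : ℂ) := by
  have hd' : (d : ℂ) ≠ 0 := by exact_mod_cast (by lia : d ≠ 0)
  ext b b'
  simp only [ptrace1, Matrix.of_apply, erasure_choi_apply]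
  induction b using Fin.lastCases <;> induction b' using Fin.lastCases <;>
    simp [ite_and, Matrix.diagonal_apply, eq_comm]
  field_simp

/-- **Mutual information of the Choi state of the qudit erasure channel.**
`I(R;B) = H(ρ_R) + H(ρ_B) − H(ρ_{RB}) = 2(1−q)log₂ d`. -/
theorem erasure_choi_mutual_information
    (d : ℕ) (hd : 1 ≤ d) (q : ℝ) (hq0 : 0 ≤ q) (hq1 : q ≤ 1) :
    vnEntropy (ptrace2 (idTensorMap (erasure d q) (maxEnt d))) +
        vnEntropy (ptrace1 (idTensorMap (erasure d q) (maxEnt d))) -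
        vnEntropy (idTensorMap (erasure d q) (maxEnt d)) =
      2 * (1 - q) * Real.logb 2 d := by
  have hd0 : (d : ℝ) ≠ 0 := by exact_mod_cast (by lia : d ≠ 0)
  rw [ptrace2_erasure_choi, ptrace1_erasure_choi d hd, erasure_choi_eq, vnEntropy_diagonal,
    vnEntropy_diagonal, vnEntropy_mul_diagonal_mul_conjTranspose _ _ _
      (erasureChoiVectors_conjTranspose_mul_self d)]
  have hlog (x : ℝ) : x * Real.logb 2 (x / d) = x * (Real.logb 2 x - Real.logb 2 d) := by
    rcases eq_or_ne x 0 with rfl | hx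
    · simp
    · rw [Real.logb_div hx hd0]
  have hq := hlog q
  have hq' := hlog (1 - q)
  simp [Fin.sum_univ_castSucc, Fintype.sum_option, hd0]
  field_simp
  linarith
end

section
/- (Impossibility of zero-error non-adaptive reading of the memory cell 𝓑.) Let A¹₁,…,A¹₅,A²₁,…,A²₅ be the explicit 2×4 Kraus matrices of the channels M¹, M² defined in the context, and for x : Fin n → {1,2} let id_r ⊗ M^{x} denote the Kraus channel on matrices over ℂ^r⊗(ℂ^4)^{⊗n} whose Kraus operators are I_r ⊗ A^{x_1}_{j_1}⊗⋯⊗A^{x_n}_{j_n} for j : Fin n → Fin 5. Then for every n ≥ 1, every pair x, y : Fin n → {1,2} with x ≠ y, every reference dimension r ≥ 1, and every density matrix σ on ℂ^r⊗(ℂ^4)^{⊗n}: Tr{(id_r⊗M^{x})(σ) · (id_r⊗M^{y})(σ)} > 0. In particular, no input state permits perfect (zero-error) discrimination of the channel sequences M^{x} and M^{y} with a non-adaptive strategy. -/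
open Matrix Kronecker BigOperators ComplexOrder

noncomputable section

/-- `1/√2` as a complex number. -/
def invSqrt2 : ℂ := ((Real.sqrt 2 : ℝ) : ℂ)⁻¹

/-- The Kraus operators of the two channels `M¹ = Acell 0` and `M² = Acell 1` of the memory
cell `𝓑`; `Acell x j` is the Kraus operator `A^{x+1}_{j+1}` of the paper. -/
def Acell : Fin 2 → Fin 5 → Matrix (Fin 2) (Fin 4) ℂ
  | 0, 0 => !![1, 0, 0, 0; 0, 0, 0, 0]                 -- |0⟩⟨00|
  | 0, 1 => !![0, 1, 0, 0; 0, 0, 0, 0]                 -- |0⟩⟨01|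
  | 0, 2 => !![0, 0, 1, 0; 0, 0, 0, 0]                 -- |0⟩⟨10|
  | 0, 3 => !![0, 0, 0, invSqrt2; 0, 0, 0, 0]          -- (1/√2)|0⟩⟨11|
  | 0, 4 => !![0, 0, 0, 0; 0, 0, 0, invSqrt2]          -- (1/√2)|1⟩⟨11|
  | 1, 0 => !![invSqrt2, 0, 0, 0; invSqrt2, 0, 0, 0]   -- |+⟩⟨00|
  | 1, 1 => !![0, invSqrt2, 0, 0; 0, invSqrt2, 0, 0]   -- |+⟩⟨01|
  | 1, 2 => !![0, 0, 0, 0; 0, 0, invSqrt2, invSqrt2]   -- |1⟩⟨1+|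
  | 1, 3 => !![0, 0, 1/2, -(1/2); 0, 0, 0, 0]          -- (1/√2)|0⟩⟨1−|
  | 1, 4 => !![0, 0, 0, 0; 0, 0, 1/2, -(1/2)]          -- (1/√2)|1⟩⟨1−|

/-- Output of the channel `id_r ⊗ M^{x_1} ⊗ ⋯ ⊗ M^{x_n}` on a state of
`ℂ^r ⊗ (ℂ^4)^{⊗n}`. -/
def nonAdaptOut (n r : ℕ) (x : Fin n → Fin 2)
    (σ : Matrix (Fin r × (Fin n → Fin 4)) (Fin r × (Fin n → Fin 4)) ℂ) :
    Matrix (Fin r × (Fin n → Fin 2)) (Fin r × (Fin n → Fin 2)) ℂ :=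
  ∑ j : Fin n → Fin 5,
    ((1 : Matrix (Fin r) (Fin r) ℂ) ⊗ₖ
        Matrix.of (fun (rr : Fin n → Fin 2) (cc : Fin n → Fin 4) => ∏ i, Acell (x i) (j i) (rr i) (cc i))) * σ *
      ((1 : Matrix (Fin r) (Fin r) ℂ) ⊗ₖ
        Matrix.of (fun (rr : Fin n → Fin 2) (cc : Fin n → Fin 4) => ∏ i, Acell (x i) (j i) (rr i) (cc i)))ᴴ

/-- The Kronecker product of a finite family of matrices. -/
def piKron {n : ℕ} {α β : Type*} (A : Fin n → Matrix α β ℂ) :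
    Matrix (Fin n → α) (Fin n → β) ℂ :=
  Matrix.of fun r c => ∏ i, A i (r i) (c i)

lemma piKron_mul {n : ℕ} {α β γ : Type*} [Fintype β] [DecidableEq β]
    (A : Fin n → Matrix α β ℂ) (B : Fin n → Matrix β γ ℂ) :
    piKron A * piKron B = piKron fun i => A i * B i := by
  ext r c
  simp [piKron, Matrix.mul_apply, Fintype.prod_sum, Finset.prod_mul_distrib]

lemma piKron_conjTranspose {n : ℕ} {α β : Type*} (A : Fin n → Matrix α β ℂ) :
    (piKron A)ᴴ = piKron fun i => (A i)ᴴ := by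
  ext r c
  simp [piKron, Matrix.conjTranspose_apply]

lemma piKron_one {n : ℕ} {α : Type*} [DecidableEq α] :
    piKron (fun _ : Fin n => (1 : Matrix α α ℂ)) = 1 := by
  ext r c
  by_cases h : r = c
  · subst h
    simp [piKron]
  · obtain ⟨i, hi⟩ := Function.ne_iff.mp h
    rw [Matrix.one_apply_ne h]
    exact Finset.prod_eq_zero (Finset.mem_univ i) (Matrix.one_apply_ne hi)

lemma piKron_sum_smul {n : ℕ} {α β ι : Type*} [Fintype ι] [DecidableEq ι]
    (c : Fin n → ι → ℂ) (A : Fin n → ι → Matrix α β ℂ) :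
    piKron (fun i => ∑ j, c i j • A i j) =
      ∑ j : Fin n → ι, (∏ i, c i (j i)) • piKron fun i => A i (j i) := by
  ext r s
  simp [piKron, Matrix.sum_apply, Fintype.prod_sum, Finset.prod_mul_distrib]

lemma invSqrt2_mul_self : invSqrt2 * invSqrt2 = 1 / 2 := by
  rw [invSqrt2, ← mul_inv, ← Complex.ofReal_mul, Real.mul_self_sqrt (by norm_num)]
  norm_num

lemma star_invSqrt2 : (starRingEnd ℂ) invSqrt2 = invSqrt2 := by
  rw [invSqrt2, map_inv₀, Complex.conj_ofReal]

/-- An upper unitriangular matrix whose Gram matrix lies in the span of the products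
`(Acell 0 j)ᴴ * Acell 1 k`. -/
def gramRoot : Matrix (Fin 4) (Fin 4) ℂ := !![1, 0, 0, 0; 0, 1, 0, 0; 0, 0, 1, -1; 0, 0, 0, 1]

lemma gramRoot_leftInverse :
    (!![1, 0, 0, 0; 0, 1, 0, 0; 0, 0, 1, 1; 0, 0, 0, 1] : Matrix (Fin 4) (Fin 4) ℂ) * gramRoot
      = 1 := by
  ext i j
  fin_cases i <;> fin_cases j <;> simp [gramRoot, Matrix.mul_apply, Fin.sum_univ_four]

/-- Coefficients expressing the Gram matrix of `gramRoot` through `(Acell 0 j)ᴴ * Acell 1 k`. -/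
def gramCoeff : Fin 5 × Fin 5 → ℂ
  | (0, 0) => 2 * invSqrt2
  | (1, 1) => 2 * invSqrt2
  | (2, 3) => 2
  | (4, 2) => 1
  | (3, 3) => -6 * invSqrt2
  | _ => 0

lemma sum_gramCoeff :
    ∑ p : Fin 5 × Fin 5, gramCoeff p • ((Acell 0 p.1)ᴴ * Acell 1 p.2) = gramRootᴴ * gramRoot := by
  have h := invSqrt2_mul_self
  rw [Fintype.sum_prod_type]
  simp only [Fin.sum_univ_five, gramCoeff, zero_smul, add_zero, zero_add]
  ext i j
  fin_cases i <;> fin_cases j <;>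
    simp [Acell, gramRoot, Matrix.mul_apply, Fin.sum_univ_four, star_invSqrt2] <;>
    grind

lemma sum_conjTranspose_mul_Acell (a : Fin 2) : ∑ j, (Acell a j)ᴴ * Acell a j = 1 := by
  have h := invSqrt2_mul_self
  fin_cases a <;> ext i j <;> fin_cases i <;> fin_cases j <;>
    simp [Acell, Matrix.mul_apply, Fin.sum_univ_five, star_invSqrt2, Complex.conj_ofNat] <;>
    grind

/-- For any two channels of the memory cell, some invertible Gram matrix lies in the span of the
products of their Kraus operators. -/
lemma exists_gram (a b : Fin 2) :
    ∃ (c : Fin 5 × Fin 5 → ℂ) (T U : Matrix (Fin 4) (Fin 4) ℂ), U * T = 1 ∧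
      ∑ p, c p • ((Acell a p.1)ᴴ * Acell b p.2) = Tᴴ * T := by
  fin_cases a <;> fin_cases b
  · exact ⟨fun p => if p.1 = p.2 then 1 else 0, 1, 1, by simp,
      by simpa [Fintype.sum_prod_type] using sum_conjTranspose_mul_Acell 0⟩
  · exact ⟨gramCoeff, gramRoot, _, gramRoot_leftInverse, sum_gramCoeff⟩
  · refine ⟨fun p => star (gramCoeff p.swap), gramRoot, _, gramRoot_leftInverse, ?_⟩
    rw [← (isHermitian_conjTranspose_mul_self gramRoot).eq, ← sum_gramCoeff,
      ← Equiv.sum_comp (Equiv.prodComm (Fin 5) (Fin 5))]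
    simp [conjTranspose_sum, conjTranspose_mul]
  · exact ⟨fun p => if p.1 = p.2 then 1 else 0, 1, 1, by simp,
      by simpa [Fintype.sum_prod_type] using sum_conjTranspose_mul_Acell 1⟩

/-- If the Kraus operators of two completely positive maps have a combination of the products
`(K j)ᴴ * L k` equal to a Gram matrix `Tᴴ * T` with `T` left invertible, then the outputs of the
two maps on any nonzero positive semidefinite matrix are not orthogonal. -/
lemma trace_krausSum_mul_pos {p q ι : Type*} [Fintype p] [DecidableEq p] [Fintype q]
    [DecidableEq q] [Fintype ι] (K L : ι → Matrix q p ℂ) (c : ι × ι → ℂ) (T U : Matrix p p ℂ)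
    (hUT : U * T = 1) (hc : ∑ s, c s • ((K s.1)ᴴ * L s.2) = Tᴴ * T)
    (σ : Matrix p p ℂ) (hσ : σ.PosSemidef) (hσ0 : σ ≠ 0) :
    0 < (((∑ j, K j * σ * (K j)ᴴ) * ∑ k, L k * σ * (L k)ᴴ).trace).re := by
  obtain ⟨B, rfl⟩ : ∃ B : Matrix p p ℂ, σ = B * Bᴴ := by
    open scoped MatrixOrder Matrix.Norms.L2Operator in
    obtain ⟨B, hB⟩ := CStarAlgebra.nonneg_iff_eq_star_mul_self.mp hσ.nonneg
    exact ⟨Bᴴ, by simpa [star_eq_conjTranspose] using hB⟩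
  let N : ι × ι → Matrix p p ℂ := fun s => Bᴴ * (K s.1)ᴴ * L s.2 * B
  have key : ((∑ j, K j * (B * Bᴴ) * (K j)ᴴ) * ∑ k, L k * (B * Bᴴ) * (L k)ᴴ).trace
      = ∑ s, (N s * (N s)ᴴ).trace := by
    rw [Finset.sum_mul_sum, ← Fintype.sum_prod_type', trace_sum]
    refine Finset.sum_congr rfl fun s _ => ?_
    have : K s.1 * (B * Bᴴ) * (K s.1)ᴴ * (L s.2 * (B * Bᴴ) * (L s.2)ᴴ)
        = (K s.1 * B) * (N s * (Bᴴ * (L s.2)ᴴ)) := by simp only [N, Matrix.mul_assoc]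
    rw [this, trace_mul_comm]
    simp only [N, conjTranspose_mul, conjTranspose_conjTranspose, Matrix.mul_assoc]
  have hnn : ∀ s, 0 ≤ (N s * (N s)ᴴ).trace := fun s =>
    (posSemidef_self_mul_conjTranspose (N s)).trace_nonneg
  rw [key]
  have hle : 0 ≤ ∑ s, (N s * (N s)ᴴ).trace := Finset.sum_nonneg fun s _ => hnn s
  have hne : ∑ s, (N s * (N s)ᴴ).trace ≠ 0 := by
    intro h0
    have hN : ∀ s, N s = 0 := fun s =>
      trace_mul_conjTranspose_self_eq_zero_iff.mp
        ((Finset.sum_eq_zero_iff_of_nonneg fun s _ => hnn s).mp h0 s (Finset.mem_univ s))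
    have hTB : (T * B)ᴴ * (T * B) = 0 := by
      calc (T * B)ᴴ * (T * B) = Bᴴ * (Tᴴ * T) * B := by
            simp only [conjTranspose_mul, Matrix.mul_assoc]
        _ = ∑ s, c s • N s := by
            rw [← hc, Finset.mul_sum, Finset.sum_mul]
            exact Finset.sum_congr rfl fun s _ => by simp [N, Matrix.mul_assoc]
        _ = 0 := by simp [hN]
    have hB : B = 0 := by
      rw [← Matrix.one_mul B, ← hUT, Matrix.mul_assoc, conjTranspose_mul_self_eq_zero.mp hTB,
        Matrix.mul_zero]
    exact hσ0 (by simp [hB])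
  exact (Complex.lt_def.mp (lt_of_le_of_ne hle hne.symm)).1

/-- **Impossibility of zero-error non-adaptive reading of the memory cell 𝓑.**
For any two distinct codewords `x ≠ y` and any input state `σ` (with any reference system),
the outputs of the channel sequences `M^x` and `M^y` have strictly positive overlap, so they can
never be perfectly discriminated by a non-adaptive strategy. -/
theorem no_zero_error_nonadaptive_reading
    (n : ℕ) (hn : 1 ≤ n) (x y : Fin n → Fin 2) (hxy : x ≠ y)
    (r : ℕ) (hr : 1 ≤ r)
    (σ : Matrix (Fin r × (Fin n → Fin 4)) (Fin r × (Fin n → Fin 4)) ℂ)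
    (hσ : σ.PosSemidef) (hσtr : σ.trace = 1) :
    0 < ((nonAdaptOut n r x σ * nonAdaptOut n r y σ).trace).re := by
  choose c T U hUT hc using fun i => exists_gram (x i) (y i)
  let e : (Fin n → Fin 5 × Fin 5) ≃ (Fin n → Fin 5) × (Fin n → Fin 5) :=
    Equiv.arrowProdEquivProdArrow _ _ _
  have hσ0 : σ ≠ 0 := by
    rintro rfl
    simp at hσtr
  refine trace_krausSum_mul_pos
    (fun j => (1 : Matrix (Fin r) (Fin r) ℂ) ⊗ₖ piKron fun i => Acell (x i) (j i))
    (fun k => (1 : Matrix (Fin r) (Fin r) ℂ) ⊗ₖ piKron fun i => Acell (y i) (k i))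
    (fun s : (Fin n → Fin 5) × (Fin n → Fin 5) => ∏ i, c i (s.1 i, s.2 i))
    (1 ⊗ₖ piKron T) (1 ⊗ₖ piKron U) ?_ ?_ σ hσ hσ0
  · rw [← mul_kronecker_mul, piKron_mul]
    simp [hUT, piKron_one]
  · have h := piKron_sum_smul c fun i p => (Acell (x i) p.1)ᴴ * Acell (y i) p.2
    simp only [hc] at h
    simp only [conjTranspose_kronecker, ← mul_kronecker_mul, piKron_conjTranspose, piKron_mul, h,
      conjTranspose_one, Matrix.one_mul]
    rw [← e.sum_comp]
    ext a b
    simp [Matrix.sum_apply, Finset.mul_sum, e, mul_left_comm]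

end
end

section
/- (Vanishing of all Kraus cross terms under perfect discrimination.) Let J, K be finite sets, let {B_j}_{j∈J} and {C_k}_{k∈K} be b×a complex matrices, and let ψ ∈ ℂ^a. If Tr{(∑_{j∈J} B_j (ψψ†) B_j†)·(∑_{k∈K} C_k (ψψ†) C_k†)} = 0, then for every family of complex coefficients c : J×K → ℂ: ψ†·(∑_{j∈J}∑_{k∈K} c(j,k)·B_j† C_k)·ψ = 0. -/
open Matrix BigOperators

theorem Matrix.mul_vecMulVec_star_mul_conjTranspose {m n R : Type*} [Fintype n]
    [CommSemiring R] [StarRing R] (A : Matrix m n R) (x : n → R) :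
    A * vecMulVec x (star x) * Aᴴ = vecMulVec (A *ᵥ x) (star (A *ᵥ x)) := by
  rw [mul_vecMulVec, vecMulVec_mul, star_mulVec]

theorem Matrix.trace_vecMulVec_star_mul_vecMulVec_star {n 𝕜 : Type*} [Fintype n] [RCLike 𝕜]
    (u v : n → 𝕜) :
    (vecMulVec u (star u) * vecMulVec v (star v)).trace = ((‖star u ⬝ᵥ v‖ ^ 2 : ℝ) : 𝕜) := by
  have huv : star v ⬝ᵥ u = star (star u ⬝ᵥ v) := star_dotProduct v u
  rw [vecMulVec_mul_vecMulVec, trace_vecMulVec, dotProduct_smul, dotProduct_comm u, huv,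
    smul_eq_mul, RCLike.star_def, RCLike.mul_conj, RCLike.ofReal_pow]

/-- **Vanishing of all Kraus cross terms under perfect discrimination.**
If the outputs of two Kraus maps on the pure state `ψψ†` are orthogonal (zero overlap), then
every linear combination of the cross operators `Bⱼ† Cₖ` has vanishing expectation on `ψ`. -/
theorem kraus_cross_terms_vanish
    {a b : ℕ} {J K : Type} [Fintype J] [Fintype K]
    (B : J → Matrix (Fin b) (Fin a) ℂ) (C : K → Matrix (Fin b) (Fin a) ℂ)
    (ψ : Fin a → ℂ)
    (h : ((∑ j, B j * Matrix.vecMulVec ψ (star ψ) * (B j)ᴴ) *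
        (∑ k, C k * Matrix.vecMulVec ψ (star ψ) * (C k)ᴴ)).trace = 0) :
    ∀ c : J × K → ℂ,
      star ψ ⬝ᵥ ((∑ j, ∑ k, c (j, k) • ((B j)ᴴ * C k)) *ᵥ ψ) = 0 := by
  have hsum : ∑ j, ∑ k, ‖star (B j *ᵥ ψ) ⬝ᵥ (C k *ᵥ ψ)‖ ^ 2 = 0 := by
    simp only [mul_vecMulVec_star_mul_conjTranspose, Finset.sum_mul, Finset.mul_sum, trace_sum,
      trace_vecMulVec_star_mul_vecMulVec_star] at h
    rw [Finset.sum_comm]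
    exact (RCLike.ofReal_eq_zero (K := ℂ)).mp (by exact_mod_cast h)
  have hcross (j : J) (k : K) : star (B j *ᵥ ψ) ⬝ᵥ (C k *ᵥ ψ) = 0 := by
    rw [Finset.sum_eq_zero_iff_of_nonneg fun _ _ => by positivity] at hsum
    have hj := hsum j (Finset.mem_univ j)
    rw [Finset.sum_eq_zero_iff_of_nonneg fun _ _ => by positivity] at hj
    simpa using hj k (Finset.mem_univ k)
  intro c
  simp only [sum_mulVec, dotProduct_sum, smul_mulVec, dotProduct_smul]
  refine Finset.sum_eq_zero fun j _ => Finset.sum_eq_zero fun k _ => ?_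
  rw [← mulVec_mulVec, dotProduct_mulVec, ← star_mulVec, hcross, smul_zero]
end
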